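/- Let C ≥ 100 be a real number, let ε, δ ∈ (0,1), and let j ≥ 1 be a real number. Define s_ℓ = (16/ε²)·log(C/δ)·2^ℓ for integers ℓ ≥ 1 and τ_j = (32/ε²)·log(C·j²/δ). Then Σ_{ℓ=1}^{∞} s_ℓ·8^{−(ℓ−1)} + 2τ_j/(log j + 1) ≤ (160/ε²)·log(C/δ). -/

import Mathlib

/-- Equation (12), Case 1 of the sample-complexity proof of Theorem 1: with
`s_ℓ = (16/ε²)·log(C/δ)·2^ℓ` and `τ_j = (32/ε²)·log(C·j²/δ)`, we have
`Σ_{ℓ=1}^∞ s_ℓ·8^{−(ℓ−1)} + 2τ_j/(log j + 1) ≤ (160/ε²)·log(C/δ)`.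
(The sum over `ℓ ≥ 1` is reindexed by `ℓ = n + 1`.) -/
theorem stmt_9 (C ε δ j : ℝ) (hC : 100 ≤ C)
    (hε : ε ∈ Set.Ioo (0 : ℝ) 1) (hδ : δ ∈ Set.Ioo (0 : ℝ) 1) (hj : 1 ≤ j) :
    (∑' n : ℕ, (16 / ε ^ 2 * Real.log (C / δ) * 2 ^ (n + 1)) * (8 : ℝ)⁻¹ ^ n) +
      2 * (32 / ε ^ 2 * Real.log (C * j ^ 2 / δ)) / (Real.log j + 1) ≤
      160 / ε ^ 2 * Real.log (C / δ) := by
  obtain ⟨hε0, -⟩ := hε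
  obtain ⟨hδ0, hδ1⟩ := hδ
  have hlog_split : Real.log (C * j ^ 2 / δ) = Real.log (C / δ) + 2 * Real.log j := by
    rw [mul_div_right_comm, Real.log_mul (by positivity) (by positivity), Real.log_pow]
    norm_num
  have hL : 2 ≤ Real.log (C / δ) := by
    rw [Real.le_log_iff_exp_le (by positivity)]
    have hexp : Real.exp 2 = Real.exp 1 ^ 2 := by rw [← Real.exp_nat_mul]; norm_num
    have hexp_lt := Real.exp_one_lt_d9
    have hC_le : C ≤ C / δ := le_div_self (by linarith) hδ0 hδ1.le
    nlinarith [Real.exp_pos 1]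
  have hx : 0 ≤ Real.log j := Real.log_nonneg hj
  rw [hlog_split]
  set L := Real.log (C / δ)
  set x := Real.log j
  have hsum : (∑' n : ℕ, (16 / ε ^ 2 * L * 2 ^ (n + 1)) * (8 : ℝ)⁻¹ ^ n) =
      128 / 3 * (L / ε ^ 2) := by
    have hterm (n : ℕ) : (16 / ε ^ 2 * L * 2 ^ (n + 1)) * (8 : ℝ)⁻¹ ^ n =
        32 * (L / ε ^ 2) * (1 / 4 : ℝ) ^ n := by
      rw [show (1 / 4 : ℝ) = 2 * 8⁻¹ by norm_num, mul_pow]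
      ring
    simp_rw [hterm]
    rw [tsum_mul_left, tsum_geometric_of_lt_one (by norm_num) (by norm_num)]
    ring
  have hthreshold : 2 * (32 / ε ^ 2 * (L + 2 * x)) / (x + 1) ≤ 64 * (L / ε ^ 2) := by
    rw [div_le_iff₀ (by linarith)]
    calc 2 * (32 / ε ^ 2 * (L + 2 * x)) = 64 / ε ^ 2 * (L + 2 * x) := by ring
      _ ≤ 64 / ε ^ 2 * (L * (x + 1)) := by gcongr; nlinarith
      _ = 64 * (L / ε ^ 2) * (x + 1) := by ring
  have hnonneg : 0 ≤ L / ε ^ 2 := by positivity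
  calc _ ≤ 128 / 3 * (L / ε ^ 2) + 64 * (L / ε ^ 2) := add_le_add hsum.le hthreshold
    _ ≤ 160 * (L / ε ^ 2) := by linarith
    _ = 160 / ε ^ 2 * L := by ring
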